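/- arXiv:math/0311403 — 2 statements merged into one kernel-verified Lean document; each statement's English description precedes it below -/
import Mathlib

section
/- Let g : [α, β] → ℝ be integrable (with 2 ≤ α < β ≤ ∞) and suppose the right-hand side below is finite. Then for any real σ and any T₁ < T₂, ∫_{T₁}^{T₂} |∫_α^β g(x) x^{-σ-it} dx|² dt ≤ 2π ∫_α^β g(x)² x^{1-2σ} dx. -/
open Complex MeasureTheory Real

open FourierTransform SchwartzMap in
lemma l2norm_aux (q : Lp ℂ 2 (volume : Measure ℝ)) : ∫ x, ‖q x‖^2 = ‖q‖^2 := by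
  have h := L2.inner_def (𝕜 := ℂ) q q
  rw [inner_self_eq_norm_sq_to_K] at h
  have : (fun a => inner ℂ (q a) (q a)) = fun a => ((‖q a‖^2 : ℝ) : ℂ) := by
    ext a; rw [inner_self_eq_norm_sq_to_K]; norm_cast
  rw [this] at h
  have h2 := integral_ofReal (𝕜 := ℂ) (μ := (volume : Measure ℝ)) (f := fun a => ‖q a‖^2)
  have h3 := h.trans h2
  exact_mod_cast h3.symm

open FourierTransform SchwartzMap in
lemma planch_ae (F : ℝ → ℂ) (h1 : Integrable F) (h2 : MemLp F 2) :
    ∀ᵐ x, (𝓕 (h2.toLp F) : Lp ℂ 2 (volume : Measure ℝ)) x = 𝓕 F x := by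
  have hcont : Continuous (𝓕 F) := 
    VectorFourier.fourierIntegral_continuous Real.continuous_fourierChar continuous_inner h1
  apply ae_eq_of_integral_contDiff_smul_eq
  · exact (Lp.memLp _).locallyIntegrable (by norm_num)
  · exact hcont.locallyIntegrable
  intro g hg hgs
  have hgc : ContDiff ℝ (⊤ : ℕ∞) (fun x => (g x : ℂ)) := Complex.ofRealCLM.contDiff.comp hg
  have hgcs : HasCompactSupport (fun x => (g x : ℂ)) := hgs.comp_left (g := fun x : ℝ => (x:ℂ)) (by simp)
  let φ : 𝓢(ℝ, ℂ) := hgcs.toSchwartzMap hgc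
  have hφ : ∀ x, φ x = (g x : ℂ) := fun x => rfl
  have e := congrArg (fun T => T φ) (Lp.fourier_toTemperedDistribution_eq (h2.toLp F))
  simp only [TemperedDistribution.fourier_apply, Lp.toTemperedDistribution_apply] at e
  have e2 : ∫ x, (𝓕 φ) x • (h2.toLp F) x = ∫ x, (𝓕 φ) x • F x := by
    apply integral_congr_ae
    filter_upwards [h2.coeFn_toLp] with x hx
    rw [hx]
  have e3 := VectorFourier.integral_fourierIntegral_smul_eq_flip (L := innerₗ ℝ)
      Real.continuous_fourierChar continuous_inner (φ.integrable (μ := volume)) h1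
  calc _ = ∫ x, φ x • (𝓕 (h2.toLp F) : Lp ℂ 2 (volume : Measure ℝ)) x := by
        simp [hφ]
    _ = ∫ x, (𝓕 φ) x • F x := by rw [← e, e2]
    _ = ∫ x, φ x • 𝓕 F x := by
        rw [SchwartzMap.fourier_coe]
        simpa using! e3
    _ = _ := by simp [hφ]

open FourierTransform in
lemma planch (F : ℝ → ℂ) (h1 : Integrable F) (h2 : MemLp F 2) :
    Integrable (fun x => ‖𝓕 F x‖^2) ∧ ∫ x, ‖𝓕 F x‖^2 = ∫ x, ‖F x‖^2 := by
  have h := planch_ae F h1 h2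
  have ha : (fun x => ‖(𝓕 (h2.toLp F) : Lp ℂ 2 (volume : Measure ℝ)) x‖^2) =ᵐ[volume] (fun x => ‖𝓕 F x‖^2) := by
    filter_upwards [h] with x hx
    rw [hx]
  constructor
  · exact (((Lp.memLp (𝓕 (h2.toLp F) : Lp ℂ 2 (volume : Measure ℝ))).integrable_norm_pow (by norm_num))).congr ha
  · rw [← integral_congr_ae ha, l2norm_aux, Lp.norm_fourier_eq, ← l2norm_aux]
    apply integral_congr_ae
    filter_upwards [h2.coeFn_toLp] with x hx
    rw [hx]

lemma chg (h : ℝ → ℂ) : ∫ x in Set.Ioi 0, h x = ∫ u : ℝ, rexp u • h (rexp u) := by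
  have := integral_image_eq_integral_abs_deriv_smul (s := Set.univ) (f := rexp) (f' := rexp) MeasurableSet.univ (fun x _ => (Real.hasDerivAt_exp x).hasDerivWithinAt) (Real.exp_injective.injOn) h
  simpa [Set.image_univ, Real.range_exp] using! this
lemma chgr (h : ℝ → ℝ) : ∫ x in Set.Ioi 0, h x = ∫ u : ℝ, rexp u • h (rexp u) := by
  have := integral_image_eq_integral_abs_deriv_smul (s := Set.univ) (f := rexp) (f' := rexp) MeasurableSet.univ (fun x _ => (Real.hasDerivAt_exp x).hasDerivWithinAt) (Real.exp_injective.injOn) h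
  simpa [Set.image_univ, Real.range_exp] using! this
lemma chgi {E : Type*} [NormedAddCommGroup E] [NormedSpace ℝ E] (h : ℝ → E) : IntegrableOn h (Set.Ioi 0) ↔ Integrable (fun u : ℝ => rexp u • h (rexp u)) := by
  have := integrableOn_image_iff_integrableOn_abs_deriv_smul (s := Set.univ) (f := rexp) (f' := rexp) MeasurableSet.univ (fun x _ => (Real.hasDerivAt_exp x).hasDerivWithinAt) (Real.exp_injective.injOn) h
  simpa [Set.image_univ, Real.range_exp] using! this
/-- Lemma 4 of [Ivić, Acta Arith. 99 (2001)]: mean-square bound for a Mellin-type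
integral. The interval `[α, β)` is a subinterval of `[2, ∞)`, possibly infinite
(`β : EReal`). -/
theorem mean_square_mellin_bound (α : ℝ) (β : EReal) (hα : 2 ≤ α) (hαβ : (α : EReal) < β)
    (g : ℝ → ℝ) (σ T₁ T₂ : ℝ) (hT : T₁ < T₂)
    (hg : IntegrableOn g {x : ℝ | α ≤ x ∧ (x : EReal) < β})
    (hfin : IntegrableOn (fun x : ℝ => g x ^ 2 * x ^ (1 - 2 * σ))
      {x : ℝ | α ≤ x ∧ (x : EReal) < β}) :
    (∫ t in Set.Ioc T₁ T₂,
        ‖∫ x in {x : ℝ | α ≤ x ∧ (x : EReal) < β},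
            (g x : ℂ) * (x : ℂ) ^ (-((σ : ℂ) + t * Complex.I))‖ ^ 2) ≤
      2 * π * ∫ x in {x : ℝ | α ≤ x ∧ (x : EReal) < β}, g x ^ 2 * x ^ (1 - 2 * σ) := by
  set S : Set ℝ := {x : ℝ | α ≤ x ∧ (x : EReal) < β} with hS
  have hSm : MeasurableSet S := by
    have : S = Set.Ici α ∩ (fun x : ℝ => (x : EReal)) ⁻¹' Set.Iio β := by
      ext x; simp [hS]
    rw [this]
    exact measurableSet_Ici.inter (measurable_coe_real_ereal measurableSet_Iio)
  have hpos : ∀ x ∈ S, 0 < x := fun x hx => by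
    have := hx.1
    linarith
  have hSsub : S ⊆ Set.Ioi 0 := hpos
  have hR : 0 ≤ 2 * π * ∫ x in S, g x ^ 2 * x ^ (1 - 2 * σ) := by
    apply mul_nonneg (by positivity)
    apply setIntegral_nonneg hSm
    intro x hx
    have := hpos x hx
    positivity
  have hnorm : ∀ t : ℝ, ∀ x ∈ S, ‖(g x : ℂ) * (x : ℂ) ^ (-((σ : ℂ) + t * Complex.I))‖
      = ‖(g x : ℂ) * (x : ℂ) ^ (-(σ : ℂ))‖ := by
    intro t x hx
    rw [norm_mul, norm_mul, Complex.norm_cpow_eq_rpow_re_of_pos (hpos x hx),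
      Complex.norm_cpow_eq_rpow_re_of_pos (hpos x hx)]
    simp
  have hmeas : AEStronglyMeasurable (fun x : ℝ => (g x : ℂ) * (x : ℂ) ^ (-(σ : ℂ)))
      (volume.restrict S) := by
    refine AEStronglyMeasurable.mul ?_ ?_
    · exact Complex.continuous_ofReal.comp_aestronglyMeasurable hg.aestronglyMeasurable
    · exact (by fun_prop : Measurable (fun x : ℝ => (x : ℂ) ^ (-(σ : ℂ)))).aestronglyMeasurable
  by_cases hI : IntegrableOn (fun x : ℝ => (g x : ℂ) * (x : ℂ) ^ (-(σ : ℂ))) S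
  swap
  · have h0 : ∀ t : ℝ, ∫ x in S, (g x : ℂ) * (x : ℂ) ^ (-((σ : ℂ) + t * Complex.I)) = 0 := by
      intro t
      apply integral_undef
      intro h
      apply hI
      refine Integrable.mono h hmeas ?_
      filter_upwards [ae_restrict_mem hSm] with x hx
      rw [hnorm t x hx]
    simp only [h0]
    simpa using hR
  let H : ℝ → ℂ := S.indicator (fun x : ℝ => (g x : ℂ) * (x : ℂ) ^ (-(σ : ℂ)))
  let F : ℝ → ℂ := fun u => rexp u • H (rexp u)
  have hF1 : Integrable F := (chgi H).1 ((integrable_indicator_iff hSm).2 hI).integrableOn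
  let K : ℝ → ℝ := S.indicator (fun x : ℝ => g x ^ 2 * x ^ (1 - 2 * σ))
  have hKF : (fun u => ‖F u‖ ^ 2) = fun u => rexp u • K (rexp u) := by
    ext u
    by_cases hu : rexp u ∈ S
    · simp only [F, H, K, Set.indicator_of_mem hu, norm_smul, norm_mul, smul_eq_mul,
        Complex.norm_cpow_eq_rpow_re_of_pos (Real.exp_pos u)]
      simp only [Complex.norm_real, Complex.neg_re, Complex.ofReal_re, mul_pow, Real.norm_eq_abs,
        sq_abs, ← Real.exp_mul]
      rw [mul_left_comm, mul_left_comm (rexp u)]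
      congr 1
      rw [← Real.exp_nat_mul, ← Real.exp_nat_mul, ← Real.exp_add, ← Real.exp_add]
      congr 1
      push_cast
      ring
    · simp [F, H, K, Set.indicator_of_notMem hu]
  have hKi : IntegrableOn K (Set.Ioi 0) := ((integrable_indicator_iff hSm).2 hfin).integrableOn
  have hF2 : MemLp F 2 := by
    rw [memLp_two_iff_integrable_sq_norm hF1.aestronglyMeasurable, hKF]
    exact (chgi K).1 hKi
  have hFK : ∫ u, ‖F u‖ ^ 2 = ∫ x in S, g x ^ 2 * x ^ (1 - 2 * σ) := by
    rw [hKF, ← chgr K, setIntegral_indicator hSm, Set.inter_eq_right.2 hSsub]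
  have hfour : ∀ t : ℝ, ∫ x in S, (g x : ℂ) * (x : ℂ) ^ (-((σ : ℂ) + t * Complex.I))
      = FourierTransform.fourier F ((2 * π)⁻¹ * t) := by
    intro t
    have e1 : ∫ x in S, (g x : ℂ) * (x : ℂ) ^ (-((σ : ℂ) + t * Complex.I)) =
        ∫ x in Set.Ioi 0, S.indicator
          (fun x : ℝ => (g x : ℂ) * (x : ℂ) ^ (-((σ : ℂ) + t * Complex.I))) x := by
      rw [setIntegral_indicator hSm, Set.inter_eq_right.2 hSsub]
    rw [e1, chg, Real.fourier_real_eq_integral_exp_smul]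
    congr 1
    ext u
    by_cases hu : rexp u ∈ S
    · simp only [F, H, Set.indicator_of_mem hu]
      have hne : ((rexp u : ℝ) : ℂ) ≠ 0 := by exact_mod_cast (Real.exp_pos u).ne'
      have e2 : ((rexp u : ℝ) : ℂ) ^ (-(t * Complex.I)) =
          cexp (((-2 * π * u * ((2 * π)⁻¹ * t) : ℝ) : ℂ) * Complex.I) := by
        rw [Complex.cpow_def_of_ne_zero hne, ← Complex.ofReal_log (Real.exp_pos u).le,
          Real.log_exp]
        congr 1
        have : -2 * π * u * ((2 * π)⁻¹ * t) = - (u * t) := by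
          field_simp
        rw [this]
        push_cast
        ring
      rw [← e2, neg_add, Complex.cpow_add _ _ hne]
      simp only [Complex.real_smul, smul_eq_mul]
      ring
    · simp [F, H, Set.indicator_of_notMem hu]
  obtain ⟨hi, he⟩ := planch F hF1 hF2
  simp only [hfour]
  have hi2 : Integrable (fun t : ℝ => ‖FourierTransform.fourier F ((2 * π)⁻¹ * t)‖ ^ 2) :=
    hi.comp_mul_left' (by positivity)
  calc _ ≤ ∫ t : ℝ, ‖FourierTransform.fourier F ((2 * π)⁻¹ * t)‖ ^ 2 :=
        setIntegral_le_integral hi2 (Filter.Eventually.of_forall fun t => by positivity)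
    _ = _ := by
        rw [Measure.integral_comp_mul_left (fun y => ‖FourierTransform.fourier F y‖ ^ 2), he, hFK,
          inv_inv, abs_of_pos (by positivity), smul_eq_mul]
end

section
/- Suppose that for fixed k ≥ 2 and every σ with 1/2 < σ ≤ 1 one has ∫_1^T |ζ(σ+it)|^{2k} dt = T ∑_{n=1}^∞ d_k²(n) n^{-2σ} + O_ε(T^{4k(1-σ)/(k+1)+ε}) for all k ≥ 2. Then ζ(σ+iT) ≪_ε T^ε for every fixed σ > 1/2, i.e. the Lindelöf hypothesis holds. -/
open Complex MeasureTheory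

/-- The Piltz divisor function `d_k(n)`, realized as the `k`-th Dirichlet
convolution power of the constant function `1`. -/
def dk (k n : ℕ) : ℕ := (ArithmeticFunction.zeta ^ k) n

noncomputable def zterm (n : ℕ) (s : ℂ) : ℂ :=
  1 / ((n : ℂ) + 1) ^ s - (((n : ℂ) + 2) ^ (1 - s) - ((n : ℂ) + 1) ^ (1 - s)) / (1 - s)

lemma cpow_diff_bound {a x : ℝ} (ha : 0 < a) (hx : a ≤ x) {s : ℂ} (hs : 0 < s.re) :
    ‖(x : ℂ) ^ (-s) - (a : ℂ) ^ (-s)‖ ≤ ‖s‖ * a ^ (-s.re - 1) * (x - a) := by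
  have hs0 : s ≠ 0 := by rintro rfl; simp at hs
  have h := norm_image_sub_le_of_norm_deriv_le_segment' (a := a) (b := x)
    (f := fun y : ℝ => (y : ℂ) ^ (-s)) (f' := fun y : ℝ => (-s) * (y : ℂ) ^ (-s - 1))
    (C := ‖s‖ * a ^ (-s.re - 1)) ?_ ?_ x ⟨hx, le_rfl⟩
  · exact h
  · intro y hy
    have hy0 : y ≠ 0 := (ha.trans_le hy.1).ne'
    exact (hasDerivAt_ofReal_cpow_const hy0 (neg_ne_zero.mpr hs0)).hasDerivWithinAt
  · intro y hy
    have hy0 : 0 < y := ha.trans_le hy.1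
    rw [norm_mul, norm_neg, norm_cpow_eq_rpow_re_of_pos hy0]
    gcongr
    simp only [sub_re, neg_re, one_re]
    exact Real.rpow_le_rpow_of_nonpos ha hy.1 (by linarith)

lemma zterm_bound (n : ℕ) {s : ℂ} (hs : 0 < s.re) (h1 : s ≠ 1) :
    ‖zterm n s‖ ≤ ‖s‖ * ((n : ℝ) + 1) ^ (-s.re - 1) := by
  set a : ℝ := (n : ℝ) + 1 with ha
  have ha0 : 0 < a := by positivity
  have h1' : (1 : ℂ) - s ≠ 0 := sub_ne_zero.mpr h1.symm
  have h := norm_image_sub_le_of_norm_deriv_le_segment' (a := a) (b := a + 1)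
    (f := fun y : ℝ => (y : ℂ) ^ (-s + 1) / (-s + 1) - (y : ℂ) * (a : ℂ) ^ (-s))
    (f' := fun y : ℝ => (y : ℂ) ^ (-s) - 1 * (a : ℂ) ^ (-s))
    (C := ‖s‖ * a ^ (-s.re - 1)) ?_ ?_ (a + 1) ⟨by linarith, le_rfl⟩
  · have e : zterm n s = -((((a + 1 : ℝ) : ℂ) ^ (-s + 1) / (-s + 1) - ((a + 1 : ℝ) : ℂ) * (a : ℂ) ^ (-s)) -
      ((a : ℂ) ^ (-s + 1) / (-s + 1) - (a : ℂ) * (a : ℂ) ^ (-s))) := by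
      have e1 : (a : ℂ) = (n : ℂ) + 1 := by simp [ha]
      have e2 : ((a + 1 : ℝ) : ℂ) = (n : ℂ) + 2 := by push_cast; rw [e1]; ring
      rw [e2, e1, zterm, cpow_neg, show -s + 1 = 1 - s by ring]
      ring
    rw [e, norm_neg]
    simpa using h
  · intro y hy
    have hy0 : y ≠ 0 := (ha0.trans_le hy.1).ne'
    refine HasDerivAt.hasDerivWithinAt ?_
    refine HasDerivAt.sub ?_ ?_
    · exact hasDerivAt_ofReal_cpow_const' hy0 (by
        intro h; apply h1; exact neg_injective h)
    · exact (HasDerivAt.ofReal_comp (hasDerivAt_id y)).mul_const _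
  · intro y hy
    rw [one_mul]
    refine (cpow_diff_bound ha0 hy.1 hs).trans ?_
    have : 0 ≤ ‖s‖ * a ^ (-s.re - 1) := by positivity
    have := hy.2
    nlinarith

lemma summable_K : Summable (fun n : ℕ => ((n : ℝ) + 1) ^ (-(9 / 8) : ℝ)) := by
  have := (summable_nat_add_iff 1).mpr (Real.summable_nat_rpow.mpr (show (-(9/8) : ℝ) < -1 by norm_num))
  simpa using this

lemma zterm_bound' (n : ℕ) {s : ℂ} (hs : 1 / 8 < s.re) (h1 : s ≠ 1) :
    ‖zterm n s‖ ≤ ‖s‖ * ((n : ℝ) + 1) ^ (-(9 / 8) : ℝ) := by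
  refine (zterm_bound n (by linarith) h1).trans ?_
  gcongr
  · linarith [(Nat.cast_nonneg n : (0:ℝ) ≤ n)]
  · linarith

lemma zeta_eq_of_one_lt {s : ℂ} (hs : 1 < s.re) :
    riemannZeta s = 1 / (s - 1) + ∑' n, zterm n s := by
  have h1 : s ≠ 1 := by rintro rfl; simp at hs
  have hsum : Summable (fun n => zterm n s) :=
    .of_norm_bounded (summable_K.mul_left ‖s‖) fun n => zterm_bound' n (by linarith) h1
  have hz : Summable (fun n : ℕ => 1 / ((n : ℂ) + 1) ^ s) := by
    have := (summable_nat_add_iff 1).mpr (Complex.summable_one_div_nat_cpow.mpr hs)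
    simpa using this
  have htel : Filter.Tendsto (fun N : ℕ => ∑ n ∈ Finset.range N,
      (((n : ℂ) + 2) ^ (1 - s) - ((n : ℂ) + 1) ^ (1 - s)) / (1 - s)) Filter.atTop
      (nhds (1 / (s - 1))) := by
    have e : ∀ N : ℕ, ∑ n ∈ Finset.range N,
      (((n : ℂ) + 2) ^ (1 - s) - ((n : ℂ) + 1) ^ (1 - s)) / (1 - s) =
        (((N : ℂ) + 1) ^ (1 - s) - 1) / (1 - s) := by
      intro N
      rw [← Finset.sum_div]
      congr 1
      have := Finset.sum_range_sub (fun n : ℕ => ((n : ℂ) + 1) ^ (1 - s)) N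
      simp only [Nat.cast_zero, zero_add, one_cpow] at this
      rw [← this]
      refine Finset.sum_congr rfl fun n _ => ?_
      push_cast
      congr 2
      ring
    simp_rw [e]
    have h0 : Filter.Tendsto (fun N : ℕ => ((N : ℂ) + 1) ^ (1 - s)) Filter.atTop (nhds 0) := by
      rw [tendsto_zero_iff_norm_tendsto_zero]
      have e2 : ∀ N : ℕ, ‖((N : ℂ) + 1) ^ (1 - s)‖ = ((N : ℝ) + 1) ^ (-(s.re - 1)) := by
        intro N
        have := norm_cpow_eq_rpow_re_of_pos (show (0:ℝ) < (N : ℝ) + 1 by positivity) (1 - s)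
        push_cast at this
        rw [this]; simp
      simp_rw [e2]
      exact (tendsto_rpow_neg_atTop (by linarith)).comp
        (Filter.tendsto_atTop_add_const_right _ _ tendsto_natCast_atTop_atTop)
    have h2 := (h0.sub_const 1).div_const (1 - s)
    convert h2 using 2
    rw [zero_sub, neg_div, ← div_neg, neg_sub]
  have hA := hz.hasSum.tendsto_sum_nat
  have hB := hsum.hasSum.tendsto_sum_nat
  rw [zeta_eq_tsum_one_div_nat_add_one_cpow hs]
  refine tendsto_nhds_unique hA ?_
  refine (htel.add hB).congr fun N => ?_
  rw [← Finset.sum_add_distrib]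
  refine Finset.sum_congr rfl fun n _ => ?_
  rw [zterm]; ring

lemma zeta_eq {s : ℂ} (hs : 1 / 8 < s.re) (hi : 0 < s.im) :
    riemannZeta s = 1 / (s - 1) + ∑' n, zterm n s := by
  set R : ℝ := ‖s‖ + 3 with hR
  set U : Set ℂ := ({z | 1 / 8 < z.re} ∩ {z | 0 < z.im}) ∩ Metric.ball 0 R with hU
  have hUo : IsOpen U :=
    ((isOpen_lt continuous_const continuous_re).inter (isOpen_lt continuous_const continuous_im)).inter
      Metric.isOpen_ball
  have hUc : Convex ℝ U :=
    ((convex_halfSpace_re_gt _).inter (convex_halfSpace_im_gt _)).inter (convex_ball _ _)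
  have hne : ∀ z ∈ U, z ≠ 1 := by
    rintro z ⟨⟨_, h⟩, _⟩ rfl; simp at h
  have hd1 : DifferentiableOn ℂ riemannZeta U := fun z hz =>
    (differentiableAt_riemannZeta (hne z hz)).differentiableWithinAt
  have hd2 : DifferentiableOn ℂ (fun z => ∑' n, zterm n z) U := by
    refine differentiableOn_tsum_of_summable_norm (summable_K.mul_left R) ?_ hUo ?_
    · intro n z hz
      have hz1 : 1 - z ≠ 0 := sub_ne_zero.mpr (hne z hz).symm
      have n1 : (n : ℂ) + 1 ≠ 0 := by exact_mod_cast Nat.succ_ne_zero n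
      have n2 : (n : ℂ) + 2 ≠ 0 := by exact_mod_cast Nat.succ_ne_zero (n + 1)
      refine DifferentiableAt.differentiableWithinAt ?_
      unfold zterm
      have c1 : ((n : ℂ) + 1) ^ z ≠ 0 := by simp [cpow_eq_zero_iff, n1]
      refine DifferentiableAt.sub (DifferentiableAt.div (by fun_prop) ?_ c1)
        (DifferentiableAt.div (DifferentiableAt.sub ?_ ?_) (by fun_prop) hz1)
      · exact differentiableAt_id.const_cpow (Or.inl n1)
      · exact DifferentiableAt.const_cpow (by fun_prop) (Or.inl n2)
      · exact DifferentiableAt.const_cpow (by fun_prop) (Or.inl n1)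
    · intro n z hz
      refine (zterm_bound' n hz.1.1 (hne z hz)).trans ?_
      have : ‖z‖ ≤ R := by simpa using (Metric.mem_ball.mp hz.2).le
      gcongr
  have hd3 : DifferentiableOn ℂ (fun z => 1 / (z - 1) + ∑' n, zterm n z) U := by
    refine DifferentiableOn.add (fun z hz => ?_) hd2
    have : DifferentiableAt ℂ (fun w : ℂ => 1 / (w - 1)) z :=
      DifferentiableAt.div (by fun_prop) (by fun_prop) (sub_ne_zero.mpr (hne z hz))
    exact this.differentiableWithinAt
  have hp : (2 + I / 2 : ℂ) ∈ U := by
    refine ⟨⟨by simp; norm_num, by simp⟩, ?_⟩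
    rw [mem_ball_zero_iff]
    refine (norm_add_le _ _).trans_lt ?_
    simp only [norm_div, norm_I, Complex.norm_ofNat]
    linarith [norm_nonneg s]
  refine (hd1.analyticOnNhd hUo).eqOn_of_preconnected_of_eventuallyEq (hd3.analyticOnNhd hUo)
    hUc.isPreconnected hp ?_ ⟨⟨hs, hi⟩, ?_⟩
  · have : {z : ℂ | 1 < z.re} ∈ nhds (2 + I / 2 : ℂ) :=
      (isOpen_lt continuous_const continuous_re).mem_nhds (by simp)
    filter_upwards [this] with z hz using zeta_eq_of_one_lt hz
  · rw [mem_ball_zero_iff, hR]; linarith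

lemma zeta_growth : ∃ K : ℝ, 0 < K ∧ ∀ s : ℂ, 1 / 8 < s.re → 1 ≤ s.im →
    ‖riemannZeta s‖ ≤ K * ‖s‖ := by
  refine ⟨1 + ∑' n : ℕ, ((n : ℝ) + 1) ^ (-(9 / 8) : ℝ), ?_, fun s hs hi => ?_⟩
  · have : 0 ≤ ∑' n : ℕ, ((n : ℝ) + 1) ^ (-(9 / 8) : ℝ) := tsum_nonneg fun n => by positivity
    linarith
  have h1 : s ≠ 1 := by rintro rfl; norm_num at hi
  rw [zeta_eq hs (by linarith), add_mul, one_mul]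
  refine (norm_add_le _ _).trans (add_le_add ?_ ?_)
  · have a : 1 ≤ ‖s‖ := hi.trans ((le_abs_self _).trans (abs_im_le_norm s))
    have b : 1 ≤ ‖s - 1‖ := by
      have := (le_abs_self _).trans (abs_im_le_norm (s - 1))
      simp at this; linarith
    rw [norm_div, norm_one]
    exact ((div_le_one (by linarith)).mpr b).trans a
  · rw [mul_comm]
    exact tsum_of_norm_bounded (summable_K.hasSum.mul_left ‖s‖) fun n => zterm_bound' n hs h1

/-- polynomial bounds for the derivative of zeta on a vertical line -/
lemma zeta_line {σ : ℝ} (h0 : 1 / 2 < σ) (h1 : σ ≤ 1) : ∃ A : ℝ, 1 ≤ A ∧ ∀ t : ℝ, 2 ≤ t →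
    ‖deriv riemannZeta ((σ : ℂ) + t * I)‖ ≤ A * t := by
  obtain ⟨K, hK, hb⟩ := zeta_growth
  refine ⟨K * 8 + 1, by linarith, fun t ht => ?_⟩
  set c : ℂ := (σ : ℂ) + t * I with hc
  have cre : c.re = σ := by simp [hc]
  have cim : c.im = t := by simp [hc]
  have key : ∀ z : ℂ, ‖z - c‖ ≤ 1 / 4 → ‖riemannZeta z‖ ≤ K * (2 * t) := by
    intro z hz
    have r := (abs_le.mp ((abs_re_le_norm (z - c)).trans hz))
    have i := (abs_le.mp ((abs_im_le_norm (z - c)).trans hz))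
    simp only [sub_re, sub_im, cre, cim] at r i
    refine (hb z (by linarith [r.1]) (by linarith [i.1])).trans ?_
    have hc' : ‖c‖ ≤ 1 + t := by
      refine (norm_add_le _ _).trans ?_
      simp only [norm_mul, norm_I, norm_real, Real.norm_eq_abs, mul_one]
      rw [abs_of_pos (by linarith), abs_of_pos (by linarith)]; linarith
    have : ‖z‖ ≤ ‖z - c‖ + ‖c‖ := by simpa using norm_add_le (z - c) c
    have : ‖z‖ ≤ 2 * t := by linarith
    gcongr
  · have hd : DiffContOnCl ℂ riemannZeta (Metric.ball c (1 / 4)) := by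
      refine DifferentiableOn.diffContOnCl fun z hz => ?_
      rw [closure_ball _ (by norm_num), mem_closedBall_iff_norm] at hz
      have i := (abs_le.mp ((abs_im_le_norm (z - c)).trans hz))
      simp only [sub_im, cim] at i
      refine (differentiableAt_riemannZeta ?_).differentiableWithinAt
      rintro rfl
      simp at i; linarith [i.1]
    have := norm_deriv_le_of_forall_mem_sphere_norm_le (by norm_num) hd
      (C := K * (2 * t)) fun z hz => key z (mem_sphere_iff_norm.mp hz).le
    linarith

lemma integral_lower {σ : ℝ} {A T : ℝ} (hA : 1 ≤ A) (hT : 2 ≤ T) (k : ℕ)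
    (hd : ∀ t : ℝ, 2 ≤ t → ‖deriv riemannZeta ((σ : ℂ) + t * I)‖ ≤ A * t)
    (hM : 1 ≤ ‖riemannZeta ((σ : ℂ) + T * I)‖) :
    (‖riemannZeta ((σ : ℂ) + T * I)‖ / 2) ^ (2 * k) / (4 * A * T) ≤
      ∫ t in Set.Icc 1 (T + 1), ‖riemannZeta ((σ : ℂ) + t * I)‖ ^ (2 * k) := by
  set f : ℝ → ℂ := fun t => riemannZeta ((σ : ℂ) + t * I) with hf
  have hder : ∀ t : ℝ, 0 < t → HasDerivAt f (deriv riemannZeta ((σ : ℂ) + t * I) * I) t := by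
    intro t ht
    have h1 : (σ : ℂ) + t * I ≠ 1 := by
      intro h
      have := congrArg Complex.im h
      simp at this; linarith
    have h2 : HasDerivAt (fun t : ℝ => (σ : ℂ) + t * I) (1 * I) t :=
      ((HasDerivAt.ofReal_comp (hasDerivAt_id t)).mul_const I).const_add _
    rw [one_mul] at h2
    exact (differentiableAt_riemannZeta h1).hasDerivAt.comp t h2
  have hδ0 : 0 < 1 / (4 * A * T) := by positivity
  have hδ1 : 1 / (4 * A * T) ≤ 1 := by
    rw [div_le_one (by positivity)]; nlinarith
  set δ : ℝ := 1 / (4 * A * T) with hδ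
  have hδA : 2 * A * T * δ = 1 / 2 := by rw [hδ]; field_simp; norm_num
  have hlow : ∀ t ∈ Set.Icc T (T + δ), ‖f T‖ / 2 ≤ ‖f t‖ := by
    intro t ht
    have h := norm_image_sub_le_of_norm_deriv_le_segment' (a := T) (b := T + δ) (f := f)
      (f' := fun t => deriv riemannZeta ((σ : ℂ) + t * I) * I) (C := 2 * A * T)
      (fun x hx => (hder x (by linarith [hx.1])).hasDerivWithinAt) ?_ t ht
    · have h3 : 2 * A * T * (t - T) ≤ 2 * A * T * δ := by
        have := ht.2
        gcongr
        linarith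
      have h4 : ‖f T‖ ≤ ‖f t‖ + ‖f t - f T‖ := by
        have := norm_sub_norm_le (f T) (f t)
        rw [norm_sub_rev] at this
        linarith
      have hM' : 1 ≤ ‖f T‖ := hM
      linarith
    · intro x hx
      rw [norm_mul, norm_I, mul_one]
      refine (hd x (by linarith [hx.1])).trans ?_
      have := hx.2
      nlinarith
  have hcont : ContinuousOn (fun t => ‖f t‖ ^ (2 * k)) (Set.Icc 1 (T + 1)) := by
    refine ContinuousOn.pow (ContinuousOn.norm fun t ht => ?_) _
    exact (hder t (by linarith [ht.1])).continuousAt.continuousWithinAt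
  have hfint : IntegrableOn (fun t => ‖f t‖ ^ (2 * k)) (Set.Icc 1 (T + 1)) :=
    hcont.integrableOn_Icc
  have hsub : Set.Icc T (T + δ) ⊆ Set.Icc 1 (T + 1) :=
    Set.Icc_subset_Icc (by linarith) (by linarith)
  calc (‖f T‖ / 2) ^ (2 * k) / (4 * A * T)
      = ∫ t in Set.Icc T (T + δ), (‖f T‖ / 2) ^ (2 * k) := by
        rw [setIntegral_const, Real.volume_real_Icc_of_le (by linarith), smul_eq_mul, hδ]
        ring
    _ ≤ ∫ t in Set.Icc T (T + δ), ‖f t‖ ^ (2 * k) := by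
        refine setIntegral_mono_on (by simp) (hfint.mono_set hsub) measurableSet_Icc ?_
        intro t ht
        have := hlow t ht
        gcongr
    _ ≤ ∫ t in Set.Icc 1 (T + 1), ‖f t‖ ^ (2 * k) :=
        setIntegral_mono_set hfint (Filter.Eventually.of_forall fun t => by positivity)
          hsub.eventuallyLE

lemma zeta_right {σ : ℝ} (h : 1 < σ) : ∃ C : ℝ, 0 < C ∧ ∀ T : ℝ,
    ‖riemannZeta ((σ : ℂ) + T * I)‖ ≤ C := by
  refine ⟨1 + ∑' n : ℕ, 1 / (n : ℝ) ^ σ, ?_, fun T => ?_⟩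
  · have : 0 ≤ ∑' n : ℕ, 1 / (n : ℝ) ^ σ := tsum_nonneg fun n => by positivity
    linarith
  · rw [zeta_eq_tsum_one_div_nat_cpow (by simpa using h)]
    have := tsum_of_norm_bounded (f := fun n : ℕ => 1 / (n : ℂ) ^ ((σ : ℂ) + T * I))
      (Real.summable_one_div_nat_rpow.mpr h).hasSum (fun n => ?_)
    · linarith
    · rw [norm_div, norm_one, norm_natCast_cpow_of_re_ne_zero _ (by simp; linarith)]
      simp

/-- If for every `k ≥ 2` and every `1/2 < σ ≤ 1` the `2k`-th moment of
`ζ(σ+it)` has the asymptotic formula with error term `O_ε(T^{4k(1-σ)/(k+1)+ε})`,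
then the Lindelöf hypothesis holds. -/
theorem moments_imply_lindelof
    (hyp : ∀ k : ℕ, 2 ≤ k → ∀ σ : ℝ, 1 / 2 < σ → σ ≤ 1 → ∀ ε : ℝ, 0 < ε →
      ∃ C : ℝ, 0 < C ∧ ∀ T : ℝ, 2 ≤ T →
        |(∫ t in Set.Icc 1 T, ‖riemannZeta ((σ : ℂ) + t * Complex.I)‖ ^ (2 * k)) -
            T * ∑' n : ℕ, (dk k n : ℝ) ^ 2 * (n : ℝ) ^ (-(2 * σ))| ≤
          C * T ^ (4 * k * (1 - σ) / (k + 1) + ε)) :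
    ∀ σ : ℝ, 1 / 2 < σ → ∀ ε : ℝ, 0 < ε → ∃ C : ℝ, 0 < C ∧ ∀ T : ℝ, 2 ≤ T →
      ‖riemannZeta ((σ : ℂ) + T * Complex.I)‖ ≤ C * T ^ ε := by
  intro σ hσ ε hε
  rcases lt_or_ge 1 σ with h1 | h1
  · obtain ⟨C, hC, hb⟩ := zeta_right h1
    refine ⟨C, hC, fun T hT => (hb T).trans ?_⟩
    exact le_mul_of_one_le_right hC.le (Real.one_le_rpow (by linarith) hε.le)
  obtain ⟨A, hA, hd⟩ := zeta_line hσ h1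
  obtain ⟨k0, hk0⟩ := exists_nat_gt (2 / ε)
  set k : ℕ := k0 + 2 with hk
  have hkε : 4 ≤ ε * ((2 * k : ℕ) : ℝ) := by
    rw [div_lt_iff₀ hε] at hk0
    push_cast [hk]
    nlinarith
  obtain ⟨C, hC, hmom⟩ := hyp k (by omega) σ hσ h1 1 one_pos
  set S : ℝ := ∑' n : ℕ, (dk k n : ℝ) ^ 2 * (n : ℝ) ^ (-(2 * σ)) with hS
  have hS0 : 0 ≤ S := tsum_nonneg fun n => by positivity
  have hexp : 4 * (k : ℝ) * (1 - σ) / (k + 1) + 1 ≤ 3 := by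
    have hkp : (0 : ℝ) ≤ k := Nat.cast_nonneg k
    have : 4 * (k : ℝ) * (1 - σ) / (k + 1) ≤ 2 := by
      rw [div_le_iff₀ (by positivity)]
      nlinarith
    linarith
  set D : ℝ := 1 + 32 * A * (S + C) with hD
  have hD1 : 1 ≤ D := by
    have : 0 ≤ 32 * A * (S + C) := by positivity
    linarith
  refine ⟨2 * D, by positivity, fun T hT => ?_⟩
  have hTε : 1 ≤ T ^ ε := Real.one_le_rpow (by linarith) hε.le
  rcases lt_or_ge ‖riemannZeta ((σ : ℂ) + T * I)‖ 1 with hM | hM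
  · nlinarith
  have hlow := integral_lower hA hT k hd hM
  have hup := (abs_le.mp (hmom (T + 1) (by linarith))).2
  set J : ℝ := ∫ t in Set.Icc 1 (T + 1), ‖riemannZeta ((σ : ℂ) + t * I)‖ ^ (2 * k) with hJ
  set M : ℝ := ‖riemannZeta ((σ : ℂ) + T * I)‖ with hMdef
  have hJ1 : J ≤ 8 * (S + C) * T ^ 3 := by
    have h2 : (T + 1) ^ (4 * (k : ℝ) * (1 - σ) / (k + 1) + 1) ≤ (T + 1) ^ (3 : ℝ) :=
      Real.rpow_le_rpow_of_exponent_le (by linarith) hexp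
    have h3 : (T + 1) ^ (3 : ℝ) = (T + 1) ^ 3 := by exact_mod_cast Real.rpow_natCast (T + 1) 3
    have h4 : (T + 1) ^ 3 ≤ (2 * T) ^ 3 := by gcongr; linarith
    have h5 : T + 1 ≤ (2 * T) ^ 3 := by nlinarith [sq_nonneg T, mul_pos (show 0 < T by linarith) (show 0 < T by linarith)]
    have h6 := mul_le_mul_of_nonneg_right h5 hS0
    have h7 := mul_le_mul_of_nonneg_left ((h2.trans_eq h3).trans h4) hC.le
    nlinarith
  have h8 : (M / 2) ^ (2 * k) ≤ D * T ^ 4 := by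
    rw [div_le_iff₀ (by positivity)] at hlow
    have : J * (4 * A * T) ≤ (8 * (S + C) * T ^ 3) * (4 * A * T) := by gcongr
    have h9 : (0:ℝ) ≤ T ^ 4 := by positivity
    nlinarith
  have h10 : (M / 2) ^ (2 * k) ≤ (D * T ^ ε) ^ (2 * k) := by
    refine h8.trans ?_
    rw [mul_pow]
    gcongr
    · exact le_self_pow₀ hD1 (by omega)
    · rw [← Real.rpow_mul_natCast (by linarith), ← Real.rpow_natCast T 4]
      exact Real.rpow_le_rpow_of_exponent_le (by linarith) (by exact_mod_cast hkε)
  have h11 := le_of_pow_le_pow_left₀ (by omega) (by positivity) h10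
  linarith
end
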